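/- Let λ_0,...,λ_n be real numbers with λ_0 ≤ λ_1, let a < b, and for k = 1,...,n let U_k = E_{(λ_0,...,λ_k)} be the space of exponential polynomials restricted to [a,b]. If λ_0 = λ_1 set f_0(x) = e^{λ_0 x} and f_1(x) = x e^{λ_0 x}; if λ_0 < λ_1 set f_0(x) = e^{λ_0 x} and f_1(x) = e^{λ_1 x}. Then for each k = 1,...,n there exists a Bernstein operator B_k : C[a,b] → U_k fixing f_0 and f_1, whose nodes are strictly increasing, and for k > 1 the nodes of B_k strictly interlace with those of B_{k−1}. -/

import Mathlib

open Finset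

noncomputable def bernOp (n : ℕ) (p : ℕ → ℝ → ℝ) (t : ℕ → ℝ) (α : ℕ → ℝ) (f : ℝ → ℝ) : ℝ → ℝ :=
  fun x => ∑ k ∈ Finset.range (n + 1), f (t k) * α k * p k x

def FixesOn (a b : ℝ) (B : (ℝ → ℝ) → ℝ → ℝ) (f : ℝ → ℝ) : Prop :=
  ∀ x ∈ Set.Icc a b, B f x = f x

/-- The first-order differential operator `d/dx − λ`. -/
noncomputable def Dop (lam : ℝ) (f : ℝ → ℝ) : ℝ → ℝ := fun x => deriv f x - lam * f x

/-- The space of exponential polynomials with exponents `lam 0, ..., lam k`: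
smooth functions annihilated by `(d/dx − lam 0) ⋯ (d/dx − lam k)`. -/
noncomputable def ExpPoly (lam : ℕ → ℝ) (k : ℕ) : Set (ℝ → ℝ) :=
  {f | ContDiff ℝ (⊤ : ℕ∞) f ∧ (List.range (k + 1)).foldr (fun i g => Dop (lam i) g) f = 0}

def IsNonnegBernsteinBasisOfSet (n : ℕ) (a b : ℝ) (U : Set (ℝ → ℝ)) (p : ℕ → ℝ → ℝ) : Prop :=
  (∀ k ≤ n, p k ∈ U) ∧
  (∀ k ≤ n, ∀ x ∈ Set.Icc a b, 0 ≤ p k x) ∧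
  (∀ k ≤ n,
    (∀ i < k, iteratedDeriv i (p k) a = 0) ∧ iteratedDeriv k (p k) a ≠ 0 ∧
    (∀ i < n - k, iteratedDeriv i (p k) b = 0) ∧ iteratedDeriv (n - k) (p k) b ≠ 0)

/-- The kernel of `(d/dx − lam 0) ⋯ (d/dx − lam (m - 1))` on smooth functions. -/
def expKer (lam : ℕ → ℝ) (m : ℕ) : Set (ℝ → ℝ) :=
  {f | ContDiff ℝ (⊤ : ℕ∞) f ∧ (List.range m).foldr (fun i g => Dop (lam i) g) f = 0}

/-- `f` has a zero of multiplicity at least `r` at `x`. -/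
def VanishesToOrder (f : ℝ → ℝ) (r : ℕ) (x : ℝ) : Prop :=
  ∀ i < r, iteratedDeriv i f x = 0

section Dop

variable {f g : ℝ → ℝ} {l μ c d x : ℝ}

theorem ContDiff.deriv_top (hf : ContDiff ℝ (⊤ : ℕ∞) f) : ContDiff ℝ (⊤ : ℕ∞) (deriv f) :=
  (contDiff_infty_iff_deriv.1 hf).2

theorem ContDiff.differentiable_top (hf : ContDiff ℝ (⊤ : ℕ∞) f) : Differentiable ℝ f :=
  (contDiff_infty_iff_deriv.1 hf).1

theorem ContDiff.dop (hf : ContDiff ℝ (⊤ : ℕ∞) f) : ContDiff ℝ (⊤ : ℕ∞) (Dop l f) :=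
  hf.deriv_top.sub (contDiff_const.mul hf)

theorem ContDiff.lin_comb (hf : ContDiff ℝ (⊤ : ℕ∞) f) (hg : ContDiff ℝ (⊤ : ℕ∞) g) :
    ContDiff ℝ (⊤ : ℕ∞) (fun x => c * f x + d * g x) :=
  (contDiff_const.mul hf).add (contDiff_const.mul hg)

theorem Dop_lin_comb (hf : ContDiff ℝ (⊤ : ℕ∞) f) (hg : ContDiff ℝ (⊤ : ℕ∞) g) :
    Dop l (fun x => c * f x + d * g x) = fun x => c * Dop l f x + d * Dop l g x := by
  funext x
  have h := ((hf.differentiable_top x).hasDerivAt.const_mul c).add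
    ((hg.differentiable_top x).hasDerivAt.const_mul d)
  have h' : deriv (fun x => c * f x + d * g x) x = c * deriv f x + d * deriv g x := h.deriv
  simp only [Dop, h']
  ring

theorem Dop_zero : Dop l 0 = 0 := by
  funext x
  simp [Dop]

theorem Dop_comm (hf : ContDiff ℝ (⊤ : ℕ∞) f) : Dop l (Dop μ f) = Dop μ (Dop l f) := by
  have key : ∀ ν : ℝ, Dop ν f = fun x => 1 * deriv f x + (-ν) * f x := fun ν => by
    funext x
    simp only [Dop]
    ring
  rw [key μ, key l, Dop_lin_comb hf.deriv_top hf, Dop_lin_comb hf.deriv_top hf]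
  funext x
  simp only [Dop]
  ring

theorem iteratedDeriv_lin_comb (hf : ContDiff ℝ (⊤ : ℕ∞) f) (hg : ContDiff ℝ (⊤ : ℕ∞) g)
    (i : ℕ) : iteratedDeriv i (fun x => c * f x + d * g x) x
      = c * iteratedDeriv i f x + d * iteratedDeriv i g x := by
  induction i generalizing f g with
  | zero => simp
  | succ i ih =>
    have h : deriv (fun x => c * f x + d * g x) = fun x => c * deriv f x + d * deriv g x := by
      funext x
      exact (((hf.differentiable_top x).hasDerivAt.const_mul c).add
        ((hg.differentiable_top x).hasDerivAt.const_mul d)).deriv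
    simp only [iteratedDeriv_succ', h]
    exact ih hf.deriv_top hg.deriv_top

theorem iteratedDeriv_Dop (hf : ContDiff ℝ (⊤ : ℕ∞) f) (i : ℕ) :
    iteratedDeriv i (Dop l f) x = iteratedDeriv (i + 1) f x - l * iteratedDeriv i f x := by
  have h : Dop l f = fun x => 1 * deriv f x + (-l) * f x := by
    funext x
    simp only [Dop]
    ring
  rw [h, iteratedDeriv_lin_comb hf.deriv_top hf, iteratedDeriv_succ']
  ring

theorem hasDerivAt_exp_neg_mul (hf : Differentiable ℝ f) (x : ℝ) :
    HasDerivAt (fun y => Real.exp (-l * y) * f y) (Real.exp (-l * x) * Dop l f x) x := by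
  have h := (((hasDerivAt_id x).const_mul (-l)).exp).mul (hf x).hasDerivAt
  refine h.congr_deriv ?_
  simp only [Dop, id]
  ring

theorem eq_zero_of_Dop_eq_zero (hf : Differentiable ℝ f) (h : Dop l f = 0) (hx : f x = 0) :
    f = 0 := by
  funext y
  have h' := is_const_of_deriv_eq_zero (f := fun y => Real.exp (-l * y) * f y)
    (fun y => (hasDerivAt_exp_neg_mul hf y).differentiableAt)
    (fun y => by rw [(hasDerivAt_exp_neg_mul hf y).deriv, h]; simp) y x
  simpa [hx, Real.exp_ne_zero] using h'

theorem exists_Dop_eq_zero {y : ℝ} (hf : Differentiable ℝ f) (hxy : x < y) (hx : f x = 0)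
    (hy : f y = 0) : ∃ z ∈ Set.Ioo x y, Dop l f z = 0 := by
  obtain ⟨z, hz, h⟩ := exists_hasDerivAt_eq_zero hxy
    (fun z _ => (hasDerivAt_exp_neg_mul (l := l) hf z).continuousAt.continuousWithinAt)
    (by simp [hx, hy]) (fun z _ => hasDerivAt_exp_neg_mul (l := l) hf z)
  exact ⟨z, hz, by simpa [Real.exp_ne_zero] using h⟩

theorem exists_finset_Dop_eq_zero {a b : ℝ} (hf : Differentiable ℝ f) (T : Finset ℝ)
    (hT : ↑T ⊆ Set.Icc a b) (h0 : ∀ x ∈ T, f x = 0) :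
    ∃ S : Finset ℝ, ↑S ⊆ Set.Ioo a b ∧ (∀ x ∈ S, Dop l f x = 0) ∧ T.card ≤ S.card + 1 := by
  obtain hN | ⟨N, hN⟩ : T.card = 0 ∨ ∃ N, T.card = N + 1 := by
    cases T.card <;> simp
  · exact ⟨∅, by simp, by simp, by simp [hN]⟩
  have hmem := T.orderEmbOfFin_mem hN
  have hmono := (T.orderEmbOfFin hN).strictMono
  set e := T.orderEmbOfFin hN
  choose z hz hz0 using fun i : Fin N => exists_Dop_eq_zero (l := l) hf
    (hmono (Fin.castSucc_lt_succ (i := i))) (h0 _ (hmem _)) (h0 _ (hmem _))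
  have hzm : StrictMono z := fun i j hij =>
    ((hz i).2.trans_le (hmono.monotone (Fin.succ_le_castSucc_iff.2 hij))).trans (hz j).1
  refine ⟨Finset.univ.image z, ?_, ?_, ?_⟩
  · intro x hx
    obtain ⟨i, -, rfl⟩ := Finset.mem_image.1 (Finset.mem_coe.1 hx)
    exact ⟨(hT (hmem _)).1.trans_lt (hz i).1, (hz i).2.trans_le (hT (hmem _)).2⟩
  · intro x hx
    obtain ⟨i, -, rfl⟩ := Finset.mem_image.1 hx
    exact hz0 i
  · rw [Finset.card_image_of_injective _ hzm.injective, hN]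
    simp

theorem exists_solution_Dop (l x : ℝ) (hg : ContDiff ℝ (⊤ : ℕ∞) g) :
    ∃ f, ContDiff ℝ (⊤ : ℕ∞) f ∧ f x = 0 ∧ Dop l f = g := by
  have hexp : ∀ r : ℝ, ContDiff ℝ (⊤ : ℕ∞) (fun y => Real.exp (r * y)) := fun r =>
    (contDiff_const.mul contDiff_id).exp
  have hh : ContDiff ℝ (⊤ : ℕ∞) (fun s => Real.exp (-l * s) * g s) := (hexp (-l)).mul hg
  have hd : ∀ y, HasDerivAt (fun y => ∫ s in x..y, Real.exp (-l * s) * g s)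
      (Real.exp (-l * y) * g y) y := fun y => hh.continuous.integral_hasStrictDerivAt x y
        |>.hasDerivAt
  have hF : ContDiff ℝ (⊤ : ℕ∞) (fun y => ∫ s in x..y, Real.exp (-l * s) * g s) := by
    refine contDiff_infty_iff_deriv.2 ⟨fun y => (hd y).differentiableAt, ?_⟩
    rwa [funext fun y => (hd y).deriv]
  refine ⟨fun y => Real.exp (l * y) * ∫ s in x..y, Real.exp (-l * s) * g s,
    (hexp l).mul hF, by simp, ?_⟩
  funext y
  have h := (((hasDerivAt_id y).const_mul l).exp).mul (hd y)
  have h' := h.deriv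
  simp only [Pi.mul_def, id] at h'
  have he : Real.exp (l * y) * Real.exp (-l * y) = 1 := by
    rw [← Real.exp_add]
    simp
  simp only [Dop]
  rw [h']
  linear_combination g y * he

end Dop

section VanishesToOrder

variable {f g : ℝ → ℝ} {l c d x : ℝ} {r s : ℕ}

theorem VanishesToOrder.mono (hf : VanishesToOrder f r x) (h : s ≤ r) : VanishesToOrder f s x :=
  fun i hi => hf i (hi.trans_le h)

theorem VanishesToOrder.lin_comb (hf : ContDiff ℝ (⊤ : ℕ∞) f) (hg : ContDiff ℝ (⊤ : ℕ∞) g)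
    (hfr : VanishesToOrder f r x) (hgr : VanishesToOrder g r x) :
    VanishesToOrder (fun x => c * f x + d * g x) r x := fun i hi => by
  rw [iteratedDeriv_lin_comb hf hg, hfr i hi, hgr i hi]
  simp

theorem VanishesToOrder.dop (hf : ContDiff ℝ (⊤ : ℕ∞) f) (h : VanishesToOrder f r x) :
    VanishesToOrder (Dop l f) (r - 1) x := fun i hi => by
  rw [iteratedDeriv_Dop hf, h i (by omega), h (i + 1) (by omega)]
  simp

theorem VanishesToOrder.of_dop (hf : ContDiff ℝ (⊤ : ℕ∞) f) (hx : f x = 0)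
    (h : VanishesToOrder (Dop l f) r x) : VanishesToOrder f (r + 1) x := by
  intro i
  induction i with
  | zero => simpa using hx
  | succ i ih =>
    intro hi
    have h' := h i (by omega)
    rw [iteratedDeriv_Dop hf, ih (by omega)] at h'
    simpa using h'

theorem VanishesToOrder.succ (h : VanishesToOrder f r x) (h' : iteratedDeriv r f x = 0) :
    VanishesToOrder f (r + 1) x := fun i hi => by
  obtain hi | rfl := Nat.lt_succ_iff_lt_or_eq.1 hi
  exacts [h i hi, h']

theorem VanishesToOrder.exists_forall_Ioo_pos (hf : ContDiff ℝ (⊤ : ℕ∞) f)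
    (h : VanishesToOrder f r x)
    (hr : 0 < iteratedDeriv r f x) : ∃ y > x, ∀ z ∈ Set.Ioo x y, 0 < f z := by
  induction r generalizing f with
  | zero =>
    have h := hf.continuous.continuousAt.eventually_const_lt (show 0 < f x by simpa using hr)
    obtain ⟨y, hy, hy'⟩ := exists_Ico_subset_of_mem_nhds h ⟨x + 1, by simp⟩
    exact ⟨y, hy, fun z hz => hy' ⟨hz.1.le, hz.2⟩⟩
  | succ r ih =>
    rw [iteratedDeriv_succ'] at hr
    obtain ⟨y, hy, hpos⟩ := ih hf.deriv_top
      (fun i hi => by rw [← iteratedDeriv_succ']; exact h (i + 1) (by omega)) hr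
    refine ⟨y, hy, fun z hz => ?_⟩
    have hx : f x = 0 := by simpa using h 0 (by omega)
    have hmono : StrictMonoOn f (Set.Icc x y) := strictMonoOn_of_deriv_pos (convex_Icc x y)
      hf.continuous.continuousOn (by simpa [interior_Icc] using hpos)
    rw [← hx]
    exact hmono ⟨le_rfl, hy.le⟩ ⟨hz.1.le, hz.2.le⟩ hz.1

theorem VanishesToOrder.iteratedDeriv_nonneg {y : ℝ} (hf : ContDiff ℝ (⊤ : ℕ∞) f)
    (h : VanishesToOrder f r x) (hxy : x < y) (hpos : ∀ z ∈ Set.Icc x y, 0 ≤ f z) :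
    0 ≤ iteratedDeriv r f x := by
  by_contra! hneg
  obtain ⟨w, hw, hw'⟩ := VanishesToOrder.exists_forall_Ioo_pos (f := -f) (r := r) (x := x) hf.neg
    (fun i hi => by simp [iteratedDeriv_neg, h i hi]) (by simpa [iteratedDeriv_neg] using hneg)
  obtain ⟨z, hz, hz'⟩ := exists_between (lt_min hw hxy)
  have h1 := hw' z ⟨hz, hz'.trans_le (min_le_left _ _)⟩
  have h2 := hpos z ⟨hz.le, (hz'.trans_le (min_le_right _ _)).le⟩
  simp only [Pi.neg_apply] at h1
  linarith

theorem VanishesToOrder.iteratedDeriv_right_nonneg {y : ℝ} (hf : ContDiff ℝ (⊤ : ℕ∞) f)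
    (h : VanishesToOrder f r y) (hxy : x < y) (hpos : ∀ z ∈ Set.Icc x y, 0 ≤ f z) :
    0 ≤ (-1) ^ r * iteratedDeriv r f y := by
  have h' := VanishesToOrder.iteratedDeriv_nonneg (f := fun z => f (-z)) (x := -y) (y := -x)
    (r := r) (hf.comp contDiff_neg) (fun i hi => by simp [iteratedDeriv_comp_neg, h i hi])
    (by linarith) (fun z hz => hpos _ ⟨by linarith [hz.2], by linarith [hz.1]⟩)
  simpa [iteratedDeriv_comp_neg] using h'

end VanishesToOrder

section expKer

variable {lam : ℕ → ℝ} {m : ℕ} {f g : ℝ → ℝ} {c d : ℝ}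

theorem mem_expKer_zero : f ∈ expKer lam 0 ↔ f = 0 := by
  refine ⟨fun h => by simpa using h.2, ?_⟩
  rintro rfl
  exact ⟨contDiff_const, rfl⟩

theorem mem_expKer_succ : f ∈ expKer lam (m + 1) ↔
    ContDiff ℝ (⊤ : ℕ∞) f ∧ Dop (lam m) f ∈ expKer lam m := by
  simp only [expKer, Set.mem_ofPred_eq, List.range_succ, List.foldr_append, List.foldr_cons,
    List.foldr_nil]
  exact ⟨fun h => ⟨h.1, h.1.dop, h.2⟩, fun h => ⟨h.1, h.2.2⟩⟩

theorem lin_comb_mem_expKer (hf : f ∈ expKer lam m) (hg : g ∈ expKer lam m) :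
    (fun x => c * f x + d * g x) ∈ expKer lam m := by
  induction m generalizing f g with
  | zero =>
    rw [mem_expKer_zero] at *
    subst hf hg
    funext x
    simp
  | succ m ih =>
    rw [mem_expKer_succ] at *
    refine ⟨hf.1.lin_comb hg.1, ?_⟩
    rw [Dop_lin_comb hf.1 hg.1]
    exact ih hf.2 hg.2

theorem Dop_mem_expKer {l : ℝ} (hf : f ∈ expKer lam m) : Dop l f ∈ expKer lam m := by
  induction m generalizing f with
  | zero =>
    rw [mem_expKer_zero] at *
    rw [hf, Dop_zero]
  | succ m ih =>
    rw [mem_expKer_succ] at *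
    refine ⟨hf.1.dop, ?_⟩
    rw [Dop_comm hf.1]
    exact ih hf.2

theorem expKer_subset_succ : expKer lam m ⊆ expKer lam (m + 1) := fun _ hf =>
  mem_expKer_succ.2 ⟨hf.1, Dop_mem_expKer hf⟩

/-- A function in `expKer lam m` with at least `m` zeros in `[a, b]` is zero, where zeros at the
end points are counted with multiplicity. -/
theorem eq_zero_of_mem_expKer {a b : ℝ} (hab : a < b) {r s : ℕ} (S : Finset ℝ)
    (hf : f ∈ expKer lam m) (ha : VanishesToOrder f r a) (hb : VanishesToOrder f s b)
    (hS : ↑S ⊆ Set.Ioo a b) (hS0 : ∀ x ∈ S, f x = 0) (hm : m ≤ r + s + S.card) : f = 0 := by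
  induction m generalizing f r s S with
  | zero => exact mem_expKer_zero.1 hf
  | succ m ih =>
    have haS : a ∉ S := fun h => lt_irrefl _ (hS h).1
    have hbS : b ∉ S := fun h => lt_irrefl _ (hS h).2
    rw [mem_expKer_succ] at hf
    obtain ⟨T, hT, hT0, hTc⟩ : ∃ T : Finset ℝ, ↑T ⊆ Set.Icc a b ∧ (∀ x ∈ T, f x = 0) ∧
        T.card + (r - 1) + (s - 1) = r + s + S.card := by
      have hA : ∃ A : Finset ℝ, ↑A ⊆ Set.Ico a b ∧ (∀ x ∈ A, f x = 0) ∧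
          A.card + (r - 1) = r + S.card := by
        rcases r.eq_zero_or_pos with rfl | hr
        · exact ⟨S, hS.trans Set.Ioo_subset_Ico_self, hS0, by omega⟩
        · refine ⟨insert a S, ?_, ?_, ?_⟩
          · rw [Finset.coe_insert]
            exact Set.insert_subset ⟨le_rfl, hab⟩ (hS.trans Set.Ioo_subset_Ico_self)
          · exact Finset.forall_mem_insert .. |>.2 ⟨by simpa using ha 0 hr, hS0⟩
          · rw [Finset.card_insert_of_notMem haS]
            omega
      obtain ⟨A, hA, hA0, hAc⟩ := hA
      have hbA : b ∉ A := fun h => lt_irrefl _ (hA h).2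
      rcases s.eq_zero_or_pos with rfl | hs
      · exact ⟨A, hA.trans Set.Ico_subset_Icc_self, hA0, by omega⟩
      · refine ⟨insert b A, ?_, ?_, ?_⟩
        · rw [Finset.coe_insert]
          exact Set.insert_subset ⟨hab.le, le_rfl⟩ (hA.trans Set.Ico_subset_Icc_self)
        · exact Finset.forall_mem_insert .. |>.2 ⟨by simpa using hb 0 hs, hA0⟩
        · rw [Finset.card_insert_of_notMem hbA]
          omega
    obtain ⟨S', hS', hS0', hc⟩ :=
      exists_finset_Dop_eq_zero (l := lam m) hf.1.differentiable_top T hT hT0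
    have h0 : Dop (lam m) f = 0 :=
      ih S' hf.2 (ha.dop hf.1) (hb.dop hf.1) hS' hS0' (by omega)
    obtain ⟨x, hx⟩ : ∃ x, f x = 0 := by
      by_contra! hne
      have hr : r = 0 := by
        by_contra hr
        exact hne a (by simpa using ha 0 (by omega))
      have hs : s = 0 := by
        by_contra hs
        exact hne b (by simpa using hb 0 (by omega))
      obtain ⟨x, hx⟩ := Finset.card_pos.1 (show 0 < S.card by omega)
      exact hne x (hS0 x hx)
    exact eq_zero_of_Dop_eq_zero hf.1.differentiable_top h0 hx

theorem eq_zero_of_vanishesToOrder {a b : ℝ} (hab : a < b) {r s : ℕ}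
    (hf : f ∈ expKer lam m) (ha : VanishesToOrder f r a) (hb : VanishesToOrder f s b)
    (hm : m ≤ r + s) : f = 0 :=
  eq_zero_of_mem_expKer hab ∅ hf ha hb (by simp) (by simp) (by simpa using hm)

theorem exists_mem_expKer_ne_zero {a b : ℝ} (hab : a < b) (lam : ℕ → ℝ) (k : ℕ) :
    ∀ j ≤ k, ∃ f ∈ expKer lam (k + 1), f ≠ 0 ∧ VanishesToOrder f j a ∧
      VanishesToOrder f (k - j) b := by
  induction k with
  | zero =>
    intro j hj
    obtain rfl : j = 0 := by omega
    refine ⟨fun x => Real.exp (lam 0 * x), ?_, fun h => ?_, ?_, ?_⟩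
    · refine mem_expKer_succ.2 ⟨(contDiff_const.mul contDiff_id).exp, mem_expKer_zero.2 ?_⟩
      funext x
      have h := (((hasDerivAt_id x).const_mul (lam 0)).exp).deriv
      simp only [id] at h
      simp only [Dop, h, Pi.zero_apply]
      ring
    · exact Real.exp_ne_zero _ (congrFun h 0)
    · exact fun i hi => absurd hi (by omega)
    · exact fun i hi => absurd hi (by omega)
  | succ k ih =>
    have hsol : ∀ j ≤ k, ∀ x, ∃ f q, f ∈ expKer lam (k + 2) ∧ f x = 0 ∧ f ≠ 0 ∧
        Dop (lam (k + 1)) f = q ∧ q ∈ expKer lam (k + 1) ∧ q ≠ 0 ∧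
        VanishesToOrder q j a ∧ VanishesToOrder q (k - j) b := by
      intro j hj x
      obtain ⟨q, hq, hq0, hqa, hqb⟩ := ih j hj
      obtain ⟨f, hf, hfx, hfq⟩ := exists_solution_Dop (lam (k + 1)) x hq.1
      refine ⟨f, q, mem_expKer_succ.2 ⟨hf, hfq ▸ hq⟩, hfx, ?_, hfq, hq, hq0, hqa, hqb⟩
      rintro rfl
      exact hq0 (hfq.symm.trans Dop_zero)
    intro j hj
    rcases j with _ | i
    · obtain ⟨f, q, hf, hfb, hf0, hfq, -, -, -, hqb⟩ := hsol 0 (by omega) b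
      exact ⟨f, hf, hf0, fun i hi => absurd hi (by omega), .of_dop hf.1 hfb (hfq ▸ hqb)⟩
    obtain ⟨u, q, hu, hua, hu0, huq, hq, hq0, hqa, hqb⟩ := hsol i (by omega) a
    have hua' : VanishesToOrder u (i + 1) a := .of_dop hu.1 hua (huq ▸ hqa)
    obtain rfl | hik : i = k ∨ i < k := by omega
    · exact ⟨u, hu, hu0, hua', fun i hi => absurd hi (by omega)⟩
    obtain ⟨v, w, hv, hva, hv0, hvw, hw, hw0, hwa, hwb⟩ := hsol (i + 1) (by omega) a
    have hva' : VanishesToOrder v (i + 2) a := .of_dop hv.1 hva (hvw ▸ hwa)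
    have hvb : v b ≠ 0 := fun hvb => hv0 <| eq_zero_of_vanishesToOrder hab hv hva'
      (VanishesToOrder.of_dop hv.1 hvb (hvw ▸ hwb)) (by omega)
    have hD : Dop (lam (k + 1)) (fun x => v b * u x + (-u b) * v x) =
        fun x => v b * q x + (-u b) * w x := by
      rw [Dop_lin_comb hu.1 hv.1, huq, hvw]
    refine ⟨fun x => v b * u x + (-u b) * v x, lin_comb_mem_expKer hu hv, ?_, ?_, ?_⟩
    · intro h
      rw [h, Dop_zero] at hD
      have hqw : q = fun x => (u b / v b) * w x + 0 * w x := by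
        funext x
        have := congrFun hD x
        simp only [Pi.zero_apply] at this
        field_simp
        linarith
      exact hq0 <| eq_zero_of_vanishesToOrder hab hq
        (hqw ▸ VanishesToOrder.lin_comb hw.1 hw.1 hwa hwa) hqb (by omega)
    · exact .lin_comb hu.1 hv.1 hua' (hva'.mono (by omega))
    · have h : VanishesToOrder (fun x => v b * u x + (-u b) * v x) (k - (i + 1) + 1) b := by
        refine .of_dop (l := lam (k + 1)) (hu.1.lin_comb hv.1) (by ring) ?_
        rw [hD]
        exact .lin_comb hq.1 hw.1 (hqb.mono (by omega)) hwb
      exact h.mono (by omega)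

theorem nonneg_of_ne_zero_on_Ioo {a b : ℝ} (hab : a < b) (hf : Continuous f)
    (h0 : ∀ x ∈ Set.Ioo a b, f x ≠ 0) :
    (∀ x ∈ Set.Icc a b, 0 ≤ f x) ∨ (∀ x ∈ Set.Icc a b, f x ≤ 0) := by
  have hcl : ∀ g : ℝ → ℝ, Continuous g → (∀ x ∈ Set.Ioo a b, 0 ≤ g x) →
      ∀ x ∈ Set.Icc a b, 0 ≤ g x := fun g hg h => by
    rw [← closure_Ioo hab.ne]
    exact fun x hx => closure_minimal h (isClosed_le continuous_const hg) hx
  by_cases h : ∀ x ∈ Set.Ioo a b, 0 ≤ f x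
  · exact .inl (hcl f hf h)
  push Not at h
  obtain ⟨y, hy, hfy⟩ := h
  refine .inr fun x hx => ?_
  have := hcl (fun x => -f x) hf.neg (fun x hx => ?_) x hx
  · linarith
  by_contra hneg
  obtain ⟨z, hz, hz0⟩ := isPreconnected_Ioo.intermediate_value hy hx hf.continuousOn
    (show (0 : ℝ) ∈ Set.Icc (f y) (f x) from ⟨hfy.le, by linarith⟩)
  exact h0 z hz hz0

theorem exists_bernstein_basis {a b : ℝ} (hab : a < b) (lam : ℕ → ℝ) (k : ℕ) :
    ∃ p, IsNonnegBernsteinBasisOfSet k a b (ExpPoly lam k) p := by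
  have key : ∀ j ≤ k, ∃ f ∈ expKer lam (k + 1), f ≠ 0 ∧ VanishesToOrder f j a ∧
      VanishesToOrder f (k - j) b ∧ ∀ x ∈ Set.Icc a b, 0 ≤ f x := by
    intro j hj
    obtain ⟨f, hf, hf0, hfa, hfb⟩ := exists_mem_expKer_ne_zero hab lam k j hj
    rcases nonneg_of_ne_zero_on_Ioo hab hf.1.continuous (fun x hx hx0 => hf0 <|
      eq_zero_of_mem_expKer hab {x} hf hfa hfb (by simpa using hx) (by simpa using hx0)
        (by rw [Finset.card_singleton]; omega)) with h | h
    · exact ⟨f, hf, hf0, hfa, hfb, h⟩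
    · refine ⟨fun x => (-1) * f x + 0 * f x, lin_comb_mem_expKer hf hf, fun h => hf0 ?_,
        .lin_comb hf.1 hf.1 hfa hfa, .lin_comb hf.1 hf.1 hfb hfb, fun x hx => ?_⟩
      · funext x
        simpa using congrFun h x
      · linarith [h x hx]
  choose! p hp hp0 hpa hpb hpos using key
  refine ⟨p, hp, hpos, fun j hj => ⟨hpa j hj, fun h => ?_, hpb j hj, fun h => ?_⟩⟩
  · exact hp0 j hj <| eq_zero_of_vanishesToOrder hab (hp j hj) ((hpa j hj).succ h) (hpb j hj)
      (by omega)
  · exact hp0 j hj <| eq_zero_of_vanishesToOrder hab (hp j hj) (hpa j hj) ((hpb j hj).succ h)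
      (by omega)

end expKer

section Elevation

variable {lam : ℕ → ℝ} {a b : ℝ} {k : ℕ}

theorem IsNonnegBernsteinBasisOfSet.iteratedDeriv_pos {p : ℕ → ℝ → ℝ} (hab : a < b)
    (hp : IsNonnegBernsteinBasisOfSet k a b (ExpPoly lam k) p) {j : ℕ} (hj : j ≤ k) :
    0 < iteratedDeriv j (p j) a ∧ 0 < (-1) ^ (k - j) * iteratedDeriv (k - j) (p j) b := by
  obtain ⟨h1, h2, h3⟩ := hp
  obtain ⟨ha, ha', hb, hb'⟩ := h3 j hj
  have hs := (h1 j hj).1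
  refine ⟨lt_of_le_of_ne (VanishesToOrder.iteratedDeriv_nonneg hs ha hab (h2 j hj)) ha'.symm,
    lt_of_le_of_ne (VanishesToOrder.iteratedDeriv_right_nonneg hs hb hab (h2 j hj)) ?_⟩
  exact (mul_ne_zero (pow_ne_zero _ (by norm_num)) hb').symm

theorem IsNonnegBernsteinBasisOfSet.exists_elevation {q p : ℕ → ℝ → ℝ} (hab : a < b)
    (hq : IsNonnegBernsteinBasisOfSet k a b (ExpPoly lam k) q)
    (hp : IsNonnegBernsteinBasisOfSet (k + 1) a b (ExpPoly lam (k + 1)) p) :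
    ∀ j ≤ k, ∃ c d : ℝ, 0 < c ∧ 0 < d ∧ ∀ x, q j x = c * p j x + d * p (j + 1) x := by
  intro j hj
  have hqj := hq.iteratedDeriv_pos hab hj
  have hpj := hp.iteratedDeriv_pos hab (show j ≤ k + 1 by omega)
  have hpj' := hp.iteratedDeriv_pos hab (show j + 1 ≤ k + 1 by omega)
  obtain ⟨hqa, -, hqb, -⟩ := hq.2.2 j hj
  obtain ⟨hpa, hpa', hpb, -⟩ := hp.2.2 j (by omega)
  obtain ⟨hpa2, -, hpb2, hpb2'⟩ := hp.2.2 (j + 1) (by omega)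
  have hqU : q j ∈ expKer lam (k + 2) := expKer_subset_succ (hq.1 j hj)
  have hpU : p j ∈ expKer lam (k + 2) := hp.1 j (by omega)
  have hpU2 : p (j + 1) ∈ expKer lam (k + 2) := hp.1 (j + 1) (by omega)
  have hkj : k + 1 - (j + 1) = k - j := by omega
  rw [hkj] at hpj' hpb2 hpb2'
  obtain ⟨c, hc⟩ : ∃ c, c = iteratedDeriv j (q j) a / iteratedDeriv j (p j) a := ⟨_, rfl⟩
  obtain ⟨d, hd⟩ : ∃ d, d = iteratedDeriv (k - j) (q j) b / iteratedDeriv (k - j) (p (j + 1)) b :=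
    ⟨_, rfl⟩
  refine ⟨c, d, hc ▸ div_pos hqj.1 hpj.1, ?_, ?_⟩
  · rw [hd, ← mul_div_mul_left _ _ (pow_ne_zero (k - j) (show (-1 : ℝ) ≠ 0 by norm_num))]
    exact div_pos hqj.2 hpj'.2
  have hr : (fun x => 1 * q j x + (-1) * (c * p j x + d * p (j + 1) x)) = 0 := by
    have hmem := lin_comb_mem_expKer (c := c) (d := d) hpU hpU2
    refine eq_zero_of_vanishesToOrder (r := j + 1) (s := k - j + 1) hab
      (lin_comb_mem_expKer hqU hmem) ?_ ?_ (by omega)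
    · refine VanishesToOrder.succ (.lin_comb hqU.1 hmem.1 hqa
        (.lin_comb hpU.1 hpU2.1 hpa (VanishesToOrder.mono hpa2 (by omega)))) ?_
      rw [iteratedDeriv_lin_comb hqU.1 hmem.1, iteratedDeriv_lin_comb hpU.1 hpU2.1,
        hpa2 j (by omega), hc]
      field_simp
      ring
    · refine VanishesToOrder.succ (.lin_comb hqU.1 hmem.1 hqb
        (.lin_comb hpU.1 hpU2.1 (VanishesToOrder.mono hpb (by omega)) hpb2)) ?_
      rw [iteratedDeriv_lin_comb hqU.1 hmem.1, iteratedDeriv_lin_comb hpU.1 hpU2.1,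
        hpb (k - j) (by omega), hd]
      field_simp
      ring
  intro x
  have := congrFun hr x
  simp only [Pi.zero_apply] at this
  linarith

end Elevation

section Nodes

/-- The functions `f0` and `φ * f0` have coefficients `γ j` and `φ (t j) * γ j` in the
basis `p`, with `γ` positive and `t` strictly increasing in `[a, b]`. -/
structure IsNodeData (a b : ℝ) (p : ℕ → ℝ → ℝ) (f0 φ : ℝ → ℝ) (k : ℕ) (γ t : ℕ → ℝ) : Prop where
  mem : ∀ j ≤ k, t j ∈ Set.Icc a b
  pos : ∀ j ≤ k, 0 < γ j
  lt : ∀ j < k, t j < t (j + 1)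
  sum_eq : ∀ x, ∑ j ∈ range (k + 1), γ j * p j x = f0 x
  sum_eq' : ∀ x, ∑ j ∈ range (k + 1), φ (t j) * γ j * p j x = φ x * f0 x

/-- The coefficients after degree elevation. -/
noncomputable def elevate (k : ℕ) (c d w : ℕ → ℝ) (j : ℕ) : ℝ :=
  (if j ≤ k then c j * w j else 0) + (if 1 ≤ j then d (j - 1) * w (j - 1) else 0)

theorem sum_elevate {k : ℕ} {c d : ℕ → ℝ} {q p : ℕ → ℝ → ℝ}
    (h : ∀ j ≤ k, ∀ x, q j x = c j * p j x + d j * p (j + 1) x) (w : ℕ → ℝ) (x : ℝ) :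
    ∑ j ∈ range (k + 2), elevate k c d w j * p j x = ∑ j ∈ range (k + 1), w j * q j x := by
  simp only [elevate, add_mul, sum_add_distrib]
  rw [sum_range_succ, sum_range_succ' (fun j => (if 1 ≤ j then _ else _) * _)]
  simp only [show ¬ k + 1 ≤ k by omega, if_false, zero_mul, add_zero, show ¬ 1 ≤ 0 by omega,
    le_add_iff_nonneg_left, zero_le, if_true, add_tsub_cancel_right]
  rw [← sum_add_distrib]
  refine sum_congr rfl fun j hj => ?_
  have hj : j ≤ k := by simpa [Nat.lt_succ_iff] using hj
  rw [if_pos hj, h j hj]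
  ring

variable {a b : ℝ} {f0 φ : ℝ → ℝ}

theorem exists_weighted_mean (hφ : StrictMono φ) (hφc : Continuous φ) {x y u v : ℝ} (hxy : x < y)
    (hu : 0 < u) (hv : 0 < v) : ∃ s ∈ Set.Ioo x y, φ s * (u + v) = φ x * u + φ y * v := by
  have hlt := hφ hxy
  obtain ⟨s, hs, h⟩ := intermediate_value_Ioo hxy.le hφc.continuousOn
    (show (φ x * u + φ y * v) / (u + v) ∈ Set.Ioo (φ x) (φ y) by
      constructor
      · rw [lt_div_iff₀ (by positivity)]
        nlinarith
      · rw [div_lt_iff₀ (by positivity)]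
        nlinarith)
  refine ⟨s, hs, ?_⟩
  rw [h]
  field_simp

theorem IsNodeData.exists_succ {k : ℕ} (hk : 1 ≤ k) {q p : ℕ → ℝ → ℝ} {γ t : ℕ → ℝ}
    (hφ : StrictMono φ) (hφc : Continuous φ)
    (hel : ∀ j ≤ k, ∃ c d : ℝ, 0 < c ∧ 0 < d ∧ ∀ x, q j x = c * p j x + d * p (j + 1) x)
    (h : IsNodeData a b q f0 φ k γ t) :
    ∃ γ' t', IsNodeData a b p f0 φ (k + 1) γ' t' ∧
      ∀ j, 1 ≤ j → j ≤ k → t (j - 1) < t' j ∧ t' j < t j := by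
  choose! c d hc hd hq using hel
  have hnode : ∀ j ≤ k + 1, ∃ s, (j = 0 → s = t 0) ∧ (j = k + 1 → s = t k) ∧
      (1 ≤ j → j ≤ k → t (j - 1) < s ∧ s < t j) ∧ 0 < elevate k c d γ j ∧
      φ s * elevate k c d γ j = elevate k c d (fun j => φ (t j) * γ j) j := by
    intro j hj
    rcases j with _ | j
    · refine ⟨t 0, fun _ => rfl, fun h => by omega, fun h => by omega, ?_, ?_⟩
      · simpa [elevate] using mul_pos (hc 0 (by omega)) (h.pos 0 (by omega))
      · simp [elevate]
        ring
    have hdj : 0 < d j * γ j := mul_pos (hd j (by omega)) (h.pos j (by omega))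
    obtain rfl | hjk : j = k ∨ j < k := by omega
    · refine ⟨t j, fun h => by omega, fun _ => rfl, fun h => by omega, ?_, ?_⟩
      · simpa [elevate] using hdj
      · simp [elevate]
        ring
    · have hcj : 0 < c (j + 1) * γ (j + 1) := mul_pos (hc _ (by omega)) (h.pos _ (by omega))
      obtain ⟨s, hs, hs'⟩ := exists_weighted_mean hφ hφc (h.lt j hjk) hdj hcj
      refine ⟨s, fun h => by omega, fun h => by omega, fun _ _ => hs, ?_, ?_⟩
      · simpa [elevate, Nat.succ_le_iff.2 hjk] using add_pos hcj hdj
      · simp only [elevate, Nat.succ_le_iff.2 hjk, if_true, le_add_iff_nonneg_left, zero_le,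
          add_tsub_cancel_right]
        linear_combination hs'
  choose! t' ht0 htk hti hpos hval using hnode
  refine ⟨elevate k c d γ, t', ⟨fun j hj => ?_, hpos, fun j hj => ?_, fun x => ?_, fun x => ?_⟩,
    fun j h1 h2 => hti j (by omega) h1 h2⟩
  · obtain rfl | rfl | hj' : j = 0 ∨ j = k + 1 ∨ (1 ≤ j ∧ j ≤ k) := by omega
    · rw [ht0 0 hj rfl]
      exact h.mem 0 (by omega)
    · rw [htk _ hj rfl]
      exact h.mem k le_rfl
    · have hs := hti j hj hj'.1 hj'.2
      exact ⟨(h.mem (j - 1) (by omega)).1.trans hs.1.le, hs.2.le.trans (h.mem j hj'.2).2⟩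
  · have hleft : t' j ≤ t j ∧ (1 ≤ j → t' j < t j) := by
      rcases j with _ | j
      · exact ⟨(ht0 0 (by omega) rfl).le, fun h => by omega⟩
      · have := (hti (j + 1) (by omega) (by omega) (by omega)).2
        exact ⟨this.le, fun _ => this⟩
    obtain rfl | hjk : j = k ∨ j < k := by omega
    · rw [htk (j + 1) le_rfl rfl]
      exact hleft.2 hk
    · exact hleft.1.trans_lt (hti (j + 1) (by omega) (by omega) (by omega)).1
  · rw [sum_elevate hq, h.sum_eq]
  · rw [← h.sum_eq', ← sum_elevate hq]
    refine sum_congr rfl fun j hj => ?_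
    rw [hval j (by simpa [Nat.lt_succ_iff] using hj)]

theorem IsNonnegBernsteinBasisOfSet.eq_add {lam : ℕ → ℝ} {p : ℕ → ℝ → ℝ} (hab : a < b)
    (hp : IsNonnegBernsteinBasisOfSet 1 a b (ExpPoly lam 1) p) {f : ℝ → ℝ}
    (hf : f ∈ ExpPoly lam 1) (x : ℝ) : f x = f a / p 0 a * p 0 x + f b / p 1 b * p 1 x := by
  obtain ⟨-, ha0, hb0, -⟩ := hp.2.2 0 (by omega)
  obtain ⟨ha1, -, -, hb1⟩ := hp.2.2 1 le_rfl
  have hpb0 : p 0 b = 0 := by simpa using hb0 0 (by omega)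
  have hpa1 : p 1 a = 0 := by simpa using ha1 0 (by omega)
  simp only [iteratedDeriv_zero, Nat.sub_self] at ha0 hb1
  have h := eq_zero_of_vanishesToOrder (m := 2) (r := 1) (s := 1) hab
    (lin_comb_mem_expKer (c := 1) (d := -1) hf
      (lin_comb_mem_expKer (c := f a / p 0 a) (d := f b / p 1 b)
        (hp.1 0 (by omega)) (hp.1 1 le_rfl)))
    (fun i hi => by
      obtain rfl : i = 0 := by omega
      simp only [iteratedDeriv_zero, hpa1]
      field_simp
      ring)
    (fun i hi => by
      obtain rfl : i = 0 := by omega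
      simp only [iteratedDeriv_zero, hpb0]
      field_simp
      ring) le_rfl
  have := congrFun h x
  simp only [Pi.zero_apply] at this
  linarith

theorem IsNonnegBernsteinBasisOfSet.exists_isNodeData {lam : ℕ → ℝ} {p : ℕ → ℝ → ℝ} (hab : a < b)
    (hp : IsNonnegBernsteinBasisOfSet 1 a b (ExpPoly lam 1) p) (h0 : f0 ∈ ExpPoly lam 1)
    (h1 : (fun x => φ x * f0 x) ∈ ExpPoly lam 1) (hpos : ∀ x, 0 < f0 x) :
    ∃ γ t, IsNodeData a b p f0 φ 1 γ t := by
  have hpa := (hp.iteratedDeriv_pos hab (show 0 ≤ 1 by omega)).1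
  have hpb := (hp.iteratedDeriv_pos hab le_rfl).2
  simp only [Nat.sub_self, pow_zero, one_mul, iteratedDeriv_zero] at hpa hpb
  refine ⟨fun j => if j = 0 then f0 a / p 0 a else f0 b / p 1 b, fun j => if j = 0 then a else b,
    ⟨fun j _ => ?_, fun j _ => ?_, fun j hj => ?_, fun x => ?_, fun x => ?_⟩⟩
  · split_ifs <;> simp [hab.le]
  · split_ifs
    exacts [div_pos (hpos a) hpa, div_pos (hpos b) hpb]
  · obtain rfl : j = 0 := by omega
    simpa using hab
  · simpa [sum_range_succ] using (hp.eq_add hab h0 x).symm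
  · have h := hp.eq_add hab h1 x
    simp only [sum_range_succ, range_zero, sum_empty, zero_add, if_true, one_ne_zero, if_false]
    linear_combination -h

end Nodes

theorem hasDerivAt_exp_mul (r x : ℝ) :
    HasDerivAt (fun x => Real.exp (r * x)) (r * Real.exp (r * x)) x := by
  simpa [mul_comm] using ((hasDerivAt_id x).const_mul r).exp

theorem exp_mul_mem_expKer_one (lam : ℕ → ℝ) :
    (fun x => Real.exp (lam 0 * x)) ∈ expKer lam 1 := by
  refine mem_expKer_succ.2 ⟨(contDiff_const.mul contDiff_id).exp, mem_expKer_zero.2 ?_⟩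
  funext x
  simp [Dop, (hasDerivAt_exp_mul (lam 0) x).deriv]

theorem exp_mul_mem_expKer_two (lam : ℕ → ℝ) :
    (fun x => Real.exp (lam 1 * x)) ∈ expKer lam 2 := by
  refine mem_expKer_succ.2 ⟨(contDiff_const.mul contDiff_id).exp, ?_⟩
  have h : Dop (lam 1) (fun x => Real.exp (lam 1 * x)) = 0 := by
    funext x
    simp [Dop, (hasDerivAt_exp_mul (lam 1) x).deriv]
  rw [h]
  exact expKer_subset_succ (mem_expKer_zero.2 rfl)

theorem mul_exp_mul_mem_expKer_two {lam : ℕ → ℝ} (h : lam 0 = lam 1) :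
    (fun x => x * Real.exp (lam 0 * x)) ∈ expKer lam 2 := by
  refine mem_expKer_succ.2 ⟨contDiff_id.mul (contDiff_const.mul contDiff_id).exp, ?_⟩
  have hD : Dop (lam 1) (fun x => x * Real.exp (lam 0 * x)) = fun x => Real.exp (lam 0 * x) := by
    funext x
    have h' := ((hasDerivAt_id x).mul (hasDerivAt_exp_mul (lam 0) x)).deriv
    simp only [Pi.mul_def, id] at h'
    simp only [Dop, h', ← h]
    ring
  rw [hD]
  exact exp_mul_mem_expKer_one lam

/-- Bernstein operators on spaces of exponential polynomials with real
exponents, with strictly increasing and strictly interlacing nodes. -/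
theorem bernstein_operator_exponential_polynomials
    (n : ℕ) (hn : 1 ≤ n) (a b : ℝ) (hab : a < b)
    (lam : ℕ → ℝ) (hlam : lam 0 ≤ lam 1)
    (f0 f1 : ℝ → ℝ)
    (hf0 : f0 = fun x => Real.exp (lam 0 * x))
    (hf1eq : lam 0 = lam 1 → f1 = fun x => x * Real.exp (lam 0 * x))
    (hf1lt : lam 0 < lam 1 → f1 = fun x => Real.exp (lam 1 * x)) :
    ∃ (p : ℕ → ℕ → ℝ → ℝ) (t : ℕ → ℕ → ℝ) (α : ℕ → ℕ → ℝ),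
      ∀ k, 1 ≤ k → k ≤ n →
        IsNonnegBernsteinBasisOfSet k a b (ExpPoly lam k) (p k) ∧
        (∀ j ≤ k, t k j ∈ Set.Icc a b) ∧
        (∀ j ≤ k, 0 < α k j) ∧
        FixesOn a b (bernOp k (p k) (t k) (α k)) f0 ∧
        FixesOn a b (bernOp k (p k) (t k) (α k)) f1 ∧
        (∀ j < k, t k j < t k (j + 1)) ∧
        (2 ≤ k → ∀ j, 1 ≤ j → j ≤ k - 1 →
          t (k - 1) (j - 1) < t k j ∧ t k j < t (k - 1) j) := by
  obtain ⟨φ, hφ, hφc, hf1, hmem⟩ : ∃ φ : ℝ → ℝ, StrictMono φ ∧ Continuous φ ∧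
      (f1 = fun x => φ x * f0 x) ∧ f1 ∈ ExpPoly lam 1 := by
    rcases hlam.eq_or_lt with h | h
    · refine ⟨id, strictMono_id, continuous_id, ?_, ?_⟩
      · rw [hf1eq h, hf0]
        rfl
      · rw [hf1eq h]
        exact mul_exp_mul_mem_expKer_two h
    · refine ⟨fun x => Real.exp ((lam 1 - lam 0) * x), fun x y hxy => ?_, by fun_prop, ?_, ?_⟩
      · exact Real.exp_lt_exp.2 (mul_lt_mul_of_pos_left hxy (sub_pos.2 h))
      · rw [hf1lt h, hf0]
        funext x
        rw [← Real.exp_add]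
        ring_nf
      · rw [hf1lt h]
        exact exp_mul_mem_expKer_two lam
  have hmem0 : f0 ∈ ExpPoly lam 1 := hf0 ▸ expKer_subset_succ (exp_mul_mem_expKer_one lam)
  have hpos : ∀ x, 0 < f0 x := fun x => by
    rw [hf0]
    exact Real.exp_pos _
  choose p hp using exists_bernstein_basis hab lam
  obtain ⟨γ₁, t₁, h₁⟩ := (hp 1).exists_isNodeData hab hmem0 (hf1 ▸ hmem) hpos
  choose! γ' t' hsucc hlace using fun (m : ℕ) (γ t : ℕ → ℝ)
    (h : IsNodeData a b (p (m + 1)) f0 φ (m + 1) γ t) =>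
      h.exists_succ (by omega) hφ hφc ((hp (m + 1)).exists_elevation hab (hp (m + 2)))
  let seq : ℕ → (ℕ → ℝ) × (ℕ → ℝ) :=
    Nat.rec (γ₁, t₁) fun m s => (γ' m s.1 s.2, t' m s.1 s.2)
  have hseq : ∀ m, IsNodeData a b (p (m + 1)) f0 φ (m + 1) (seq m).1 (seq m).2 := fun m => by
    induction m with
    | zero => exact h₁
    | succ m ih => exact hsucc m _ _ ih
  refine ⟨p, fun k => (seq (k - 1)).2, fun k j => (seq (k - 1)).1 j / f0 ((seq (k - 1)).2 j),
    fun k hk _ => ?_⟩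
  obtain ⟨m, rfl⟩ : ∃ m, k = m + 1 := ⟨k - 1, by omega⟩
  simp only [add_tsub_cancel_right]
  have h := hseq m
  refine ⟨hp _, h.mem, fun j hj => div_pos (h.pos j hj) (hpos _), fun x _ => ?_, fun x _ => ?_,
    h.lt, fun hm j h1 h2 => ?_⟩
  · rw [← h.sum_eq x]
    refine sum_congr rfl fun j _ => ?_
    rw [mul_div_cancel₀ _ (hpos _).ne']
  · simp only [hf1]
    rw [← h.sum_eq' x]
    refine sum_congr rfl fun j _ => ?_
    rw [mul_assoc (φ _), mul_div_cancel₀ _ (hpos _).ne']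
  · obtain ⟨i, rfl⟩ : ∃ i, m = i + 1 := ⟨m - 1, by omega⟩
    exact hlace i _ _ (hseq i) j h1 h2
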